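/- arXiv:math/0611355 — 5 statements merged into one kernel-verified Lean document; each statement's English description precedes it below -/
import Mathlib

section
/- Let A be an associative unital ring, let u, v ∈ A, and let c ∈ A be an element that commutes with both u and v and satisfies u·v − v·u = c. Then for all natural numbers m and n, u^m · v^n = ∑_{k=0}^{min(m,n)} C(m,k)·C(n,k)·k!·c^k·v^{n−k}·u^{m−k}, where C(·,·) denotes the binomial coefficient. -/
open Finset

section CentralCommutator

variable {A : Type*} [Ring A] {u v c : A}

theorem mul_pow_of_commutator_commute (hcv : Commute c v) (h : u * v - v * u = c) (n : ℕ) :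
    u * v ^ n = v ^ n * u + n • (c * v ^ (n - 1)) := by
  induction n with
  | zero => simp
  | succ n ih =>
    have huv : u * v = v * u + c := by rw [← h]; abel
    have hterm : n • (c * v ^ (n - 1)) * v = n • (c * v ^ n) := by
      cases n with
      | zero => simp
      | succ n => rw [smul_mul_assoc, mul_assoc, Nat.add_sub_cancel, ← pow_succ]
    rw [pow_succ, ← mul_assoc, ih, add_mul, hterm, mul_assoc, huv, mul_add, ← mul_assoc,
      ← (hcv.pow_right n).eq, Nat.add_sub_cancel, succ_nsmul']
    abel

theorem pow_mul_pow_eq_sum_choose_descFactorial (hcu : Commute c u) (hcv : Commute c v)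
    (h : u * v - v * u = c) (m n : ℕ) :
    u ^ m * v ^ n =
      ∑ k ∈ range (m + 1),
        m.choose k • n.descFactorial k • (c ^ k * v ^ (n - k) * u ^ (m - k)) := by
  induction m with
  | zero => simp
  | succ m ih =>
    rw [sum_choose_succ_nsmul
      (fun i j => n.descFactorial i • (c ^ i * v ^ (n - i) * u ^ j)) m,
      pow_succ', mul_assoc, ih, mul_sum, ← sum_add_distrib]
    refine sum_congr rfl fun k hk => ?_
    have hkm : m + 1 - k = (m - k) + 1 := by
      have := mem_range.mp hk
      omega
    rw [mul_smul_comm, mul_smul_comm, ← smul_add, Nat.descFactorial_succ, mul_comm (n - k),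
      mul_smul, ← smul_add, ← mul_assoc, ← mul_assoc, ← (hcu.pow_left k).eq, mul_assoc (c ^ k) u,
      mul_pow_of_commutator_commute hcv h, hkm, pow_succ' u, pow_succ c, Nat.sub_add_eq]
    simp only [mul_add, add_mul, mul_assoc, mul_smul_comm, smul_mul_assoc]

end CentralCommutator


/-- Weyl-algebra reordering identity: if `c = u*v - v*u` commutes with `u` and `v`, then
`u^m * v^n = ∑_{k=0}^{min m n} C(m,k) C(n,k) k! c^k v^{n-k} u^{m-k}`. -/
theorem weyl_reordering {A : Type*} [Ring A] (u v c : A)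
    (hcu : Commute c u) (hcv : Commute c v) (h : u * v - v * u = c) (m n : ℕ) :
    u ^ m * v ^ n =
      ∑ k ∈ Finset.range (min m n + 1),
        (m.choose k : A) * (n.choose k : A) * (Nat.factorial k : A) *
          c ^ k * v ^ (n - k) * u ^ (m - k) := by
  rw [pow_mul_pow_eq_sum_choose_descFactorial hcu hcv h]
  symm
  refine sum_subset_zero_on_sdiff (range_mono (by omega)) (fun k hk => ?_) (fun k _ => ?_)
  · simp only [mem_sdiff, mem_range] at hk
    rw [Nat.descFactorial_of_lt (by omega), zero_smul, smul_zero]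
  · rw [Nat.descFactorial_eq_factorial_mul_choose, mul_comm k.factorial]
    simp only [nsmul_eq_mul, Nat.cast_mul, mul_assoc]
end

section
/- Let N be a natural number, let K = fromBlocks (i·1) 0 0 (−i·1) be the (2N)×(2N) complex block-diagonal matrix with blocks i·I_N and −i·I_N, and let M be a (2N)×(2N) complex matrix. Then M belongs to the symplectic group Sp(2N,ℂ) and satisfies M·K = K·M if and only if there exists an invertible A ∈ M_N(ℂ) with M = fromBlocks A 0 0 (Aᵀ)⁻¹. -/
open Matrix

/-- A block-diagonal matrix is symplectic iff its blocks are inverse transposes of each other. -/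
theorem fromBlocks_diagonal_mem_symplecticGroup_iff {l R : Type*} [DecidableEq l] [Fintype l]
    [CommRing R] {A D : Matrix l l R} :
    fromBlocks A 0 0 D ∈ symplecticGroup l R ↔ D * Aᵀ = 1 := by
  have transpose_iff : A * Dᵀ = 1 ↔ D * Aᵀ = 1 := by
    rw [← transpose_inj, transpose_mul, transpose_transpose, transpose_one]
  simp [SymplecticGroup.mem_iff, J, fromBlocks_transpose, fromBlocks_multiply, fromBlocks_inj,
    transpose_iff]

theorem IsUnit.smul_eq_smul_iff_eq_zero {R V : Type*} [Ring R] [AddCommGroup V] [Module R V]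
    {a b : R} (hab : IsUnit (a - b)) {x : V} : a • x = b • x ↔ x = 0 := by
  rw [← sub_eq_zero, ← sub_smul, hab.smul_eq_zero]

/-- If `a - b` is a unit, a block matrix commutes with `fromBlocks (a • 1) 0 0 (b • 1)`
iff it is block diagonal. -/
theorem fromBlocks_mul_scalar_blocks_comm_iff {l m R : Type*} [DecidableEq l] [Fintype l]
    [DecidableEq m] [Fintype m] [CommRing R] {a b : R} (hab : IsUnit (a - b))
    {A : Matrix l l R} {B : Matrix l m R} {C : Matrix m l R} {D : Matrix m m R} :
    fromBlocks A B C D * fromBlocks (a • 1) 0 0 (b • 1) =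
      fromBlocks (a • 1) 0 0 (b • 1) * fromBlocks A B C D ↔ B = 0 ∧ C = 0 := by
  simp [fromBlocks_multiply, fromBlocks_inj, eq_comm (a := b • B), hab.smul_eq_smul_iff_eq_zero]

/-- A matrix `M` is symplectic and commutes with `K = fromBlocks (i•1) 0 0 (-i•1)`
if and only if `M = fromBlocks A 0 0 (Aᵀ)⁻¹` for some invertible `A`. -/
theorem mem_symplecticGroup_and_commute_iff (N : ℕ)
    (M : Matrix (Fin N ⊕ Fin N) (Fin N ⊕ Fin N) ℂ) :
    (M ∈ Matrix.symplecticGroup (Fin N) ℂ ∧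
        M * Matrix.fromBlocks (Complex.I • 1) 0 0 (-Complex.I • 1) =
          Matrix.fromBlocks (Complex.I • 1) 0 0 (-Complex.I • 1) * M) ↔
      ∃ A : Matrix (Fin N) (Fin N) ℂ,
        IsUnit A ∧ M = Matrix.fromBlocks A 0 0 (Aᵀ)⁻¹ := by
  have hI : IsUnit (Complex.I - -Complex.I) :=
    (sub_ne_zero.mpr (self_ne_neg.mpr Complex.I_ne_zero)).isUnit
  constructor
  · rintro ⟨hM, hK⟩
    rw [← fromBlocks_toBlocks M] at hM hK
    obtain ⟨hB, hC⟩ := (fromBlocks_mul_scalar_blocks_comm_iff hI).mp hK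
    rw [hB, hC, fromBlocks_diagonal_mem_symplecticGroup_iff] at hM
    refine ⟨M.toBlocks₁₁, ?_, ?_⟩
    · exact (isUnit_transpose _).mp (IsUnit.of_mul_eq_one_right _ hM)
    · rw [inv_eq_left_inv hM]
      conv_lhs => rw [← fromBlocks_toBlocks M, hB, hC]
  · rintro ⟨A, hA, rfl⟩
    refine ⟨fromBlocks_diagonal_mem_symplecticGroup_iff.mpr ?_,
      (fromBlocks_mul_scalar_blocks_comm_iff hI).mpr ⟨rfl, rfl⟩⟩
    exact nonsing_inv_mul _ ((isUnit_iff_isUnit_det _).mp ((isUnit_transpose A).mpr hA))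
end

section
/- Let N be a natural number and let K = fromBlocks (i·1) 0 0 (−i·1), which is an element of the symplectic group Sp(2N,ℂ). Then the centralizer of K in Sp(2N,ℂ) is isomorphic, as a group, to the general linear group GL_N(ℂ). -/
open Matrix

/-- A block matrix commutes with a block-diagonal matrix having distinct scalar blocks if and only
if its off-diagonal blocks vanish. -/
theorem Matrix.commute_fromBlocks_smul_one_iff {m n R : Type*} [Fintype m] [Fintype n]
    [DecidableEq m] [DecidableEq n] [CommRing R] [IsDomain R] {a b : R} (hab : a ≠ b)
    (A : Matrix m m R) (B : Matrix m n R) (C : Matrix n m R) (D : Matrix n n R) :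
    Commute (fromBlocks A B C D) (fromBlocks (a • 1) 0 0 (b • 1)) ↔ B = 0 ∧ C = 0 := by
  simp only [commute_iff_eq, fromBlocks_multiply, fromBlocks_inj, Matrix.mul_smul,
    Matrix.smul_mul, Matrix.mul_one, Matrix.one_mul, Matrix.mul_zero, Matrix.zero_mul, add_zero,
    zero_add, true_and, and_true]
  rw [← sub_eq_zero (a := b • B), ← sub_smul, smul_eq_zero_iff_right (sub_ne_zero.2 hab.symm),
    ← sub_eq_zero (a := a • C), ← sub_smul, smul_eq_zero_iff_right (sub_ne_zero.2 hab)]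

namespace SymplecticGroup

variable {l R : Type*} [DecidableEq l] [Fintype l] [CommRing R]

theorem fromBlocks_diagonal_mem_iff {A D : Matrix l l R} :
    fromBlocks A 0 0 D ∈ symplecticGroup l R ↔ Aᵀ * D = 1 := by
  simp [fromBlocks_mem_iff]

variable (l R) in
/-- The embedding `A ↦ fromBlocks A 0 0 (A⁻¹)ᵀ` of the general linear group into the symplectic
group. -/
def ofGL : GL l R →* symplecticGroup l R where
  toFun A := ⟨fromBlocks A.val 0 0 (A⁻¹).valᵀ, fromBlocks_diagonal_mem_iff.2 <| by
    rw [← transpose_mul, Units.inv_mul, transpose_one]⟩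
  map_one' := Subtype.ext <| by simp
  map_mul' A B := Subtype.ext <| by
    simp only [Submonoid.coe_mul, fromBlocks_multiply, _root_.mul_inv_rev, Units.val_mul,
      transpose_mul]
    simp

theorem coe_ofGL (A : GL l R) :
    (ofGL l R A : Matrix (l ⊕ l) (l ⊕ l) R) = fromBlocks A.val 0 0 (A⁻¹).valᵀ := rfl

theorem ofGL_injective : Function.Injective (ofGL l R) := fun _ _ h ↦
  Units.ext (fromBlocks_inj.1 (congrArg Subtype.val h)).1

theorem fromBlocks_diagonal_mem_range_ofGL {A D : Matrix l l R}
    (h : fromBlocks A 0 0 D ∈ symplecticGroup l R) :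
    (⟨fromBlocks A 0 0 D, h⟩ : symplecticGroup l R) ∈ (ofGL l R).range := by
  have hD : Dᵀ * A = 1 := by
    simpa using congrArg transpose (fromBlocks_diagonal_mem_iff.1 h)
  refine ⟨⟨A, Dᵀ, mul_eq_one_comm.1 hD, hD⟩, Subtype.ext ?_⟩
  simp [coe_ofGL]

/-- The centralizer of a symplectic block-diagonal matrix with distinct scalar blocks is the image
of the general linear group. -/
theorem range_ofGL_eq_centralizer [IsDomain R] {a b : R} (hab : a ≠ b)
    (h : fromBlocks (a • 1) 0 0 (b • 1) ∈ symplecticGroup l R) :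
    (ofGL l R).range = Subgroup.centralizer {⟨fromBlocks (a • 1) 0 0 (b • 1), h⟩} := by
  ext ⟨M, hM⟩
  rw [Subgroup.mem_centralizer_singleton_iff]
  constructor
  · rintro ⟨A, hA⟩
    rw [← hA]
    exact Subtype.ext ((commute_fromBlocks_smul_one_iff hab _ _ _ _).2 ⟨rfl, rfl⟩)
  · intro hcomm
    obtain ⟨A, B, C, D, rfl⟩ : ∃ A B C D, M = fromBlocks A B C D :=
      ⟨_, _, _, _, (fromBlocks_toBlocks M).symm⟩
    obtain ⟨rfl, rfl⟩ :=
      (commute_fromBlocks_smul_one_iff hab A B C D).1 (congrArg Subtype.val hcomm)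
    exact fromBlocks_diagonal_mem_range_ofGL hM

end SymplecticGroup

/-- The matrix `K = fromBlocks (i•1) 0 0 (-i•1)` belongs to the symplectic group
`Sp(2N, ℂ)`, and its centralizer there is isomorphic to `GL N ℂ`. -/
theorem centralizer_K_iso_GL (N : ℕ) :
    ∃ hK : Matrix.fromBlocks (Complex.I • 1) 0 0 (-Complex.I • 1) ∈
        Matrix.symplecticGroup (Fin N) ℂ,
      Nonempty
        (Subgroup.centralizer
            ({⟨Matrix.fromBlocks (Complex.I • 1) 0 0 (-Complex.I • 1), hK⟩} :
              Set (Matrix.symplecticGroup (Fin N) ℂ)) ≃* GL (Fin N) ℂ) := by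
  have hK : Matrix.fromBlocks (Complex.I • 1) 0 0 (-Complex.I • 1) ∈
      Matrix.symplecticGroup (Fin N) ℂ :=
    SymplecticGroup.fromBlocks_diagonal_mem_iff.2 (by simp [smul_smul])
  have hI : Complex.I ≠ -Complex.I := self_ne_neg.2 Complex.I_ne_zero
  exact ⟨hK, ⟨((MonoidHom.ofInjective SymplecticGroup.ofGL_injective).trans
    (MulEquiv.subgroupCongr (SymplecticGroup.range_ofGL_eq_centralizer hI hK))).symm⟩⟩
end

section
/- For every τ ∈ ℂ with Im τ > 0 and every z ∈ ℂ, the family indexed by m ∈ ℕ with m-th term (1 − e^{2πi(m+1)τ})·(1 + e^{2πiz}·e^{πi(2m+1)τ})·(1 + e^{−2πiz}·e^{πi(2m+1)τ}) is multipliable, and its infinite product equals the Jacobi theta function ϑ(z|τ) = ∑_{m∈ℤ} e^{2πizm + πiτm²}. -/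
open Complex

open Filter Topology

/-- The finite product `(q; q)_n = ∏_{i < n} (1 - q ^ (i + 1))`. -/
noncomputable def eulerProd (q : ℂ) (n : ℕ) : ℂ := ∏ i ∈ Finset.range n, (1 - q ^ (i + 1))

/-- The reciprocal of `(q; q)_k`, extended by zero to negative integers `k`. -/
noncomputable def invEulerProd (q : ℂ) (k : ℤ) : ℂ :=
  if 0 ≤ k then (eulerProd q k.toNat)⁻¹ else 0

lemma one_sub_pow_succ_ne_zero {q : ℂ} (hq : ‖q‖ < 1) (n : ℕ) : 1 - q ^ (n + 1) ≠ 0 := by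
  intro h
  have h1 : ‖q ^ (n + 1)‖ < 1 := by
    rw [norm_pow]
    exact pow_lt_one₀ (norm_nonneg q) hq n.succ_ne_zero
  rw [← sub_eq_zero.mp h, norm_one] at h1
  exact lt_irrefl _ h1

lemma eulerProd_ne_zero {q : ℂ} (hq : ‖q‖ < 1) (n : ℕ) : eulerProd q n ≠ 0 :=
  Finset.prod_ne_zero_iff.mpr fun i _ => one_sub_pow_succ_ne_zero hq i

lemma eulerProd_succ (q : ℂ) (n : ℕ) :
    eulerProd q (n + 1) = eulerProd q n * (1 - q ^ (n + 1)) :=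
  Finset.prod_range_succ _ n

lemma invEulerProd_sub_one {q : ℂ} (hq : ‖q‖ < 1) (k : ℤ) :
    invEulerProd q (k - 1) = (1 - q ^ k) * invEulerProd q k := by
  rcases lt_trichotomy k 0 with hk | rfl | hk
  · simp [invEulerProd, show ¬ 1 ≤ k by omega, hk.not_ge]
  · simp [invEulerProd]
  · obtain ⟨n, rfl⟩ : ∃ n : ℕ, k = n + 1 := ⟨(k - 1).toNat, by omega⟩
    have h1 : ((n : ℤ) + 1).toNat = n + 1 := by omega
    have h2 : q ^ ((n : ℤ) + 1) = q ^ (n + 1) := by exact_mod_cast zpow_natCast q (n + 1)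
    rw [invEulerProd, invEulerProd, if_pos (by omega), if_pos (by omega), h1, eulerProd_succ, h2]
    have := one_sub_pow_succ_ne_zero hq n
    have := eulerProd_ne_zero hq n
    simp
    field_simp

/-- The finite form of the Jacobi triple product identity (Cauchy's `q`-binomial theorem). -/
lemma hasSum_finite_jacobi_triple_product {p x : ℂ} (hp0 : p ≠ 0) (hp : ‖p ^ 2‖ < 1) (hx : x ≠ 0)
    (N : ℕ) :
    HasSum (fun k : ℤ => eulerProd (p ^ 2) (2 * N) * invEulerProd (p ^ 2) (N + k) *
        invEulerProd (p ^ 2) (N - k) * (p ^ (k ^ 2) * x ^ k))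
      (∏ m ∈ Finset.range N, (1 + x * p ^ (2 * m + 1)) * (1 + x⁻¹ * p ^ (2 * m + 1))) := by
  induction N with
  | zero =>
    have h := hasSum_single (f := fun k : ℤ => eulerProd (p ^ 2) (2 * 0) *
      invEulerProd (p ^ 2) ((0 : ℕ) + k) * invEulerProd (p ^ 2) ((0 : ℕ) - k) *
        (p ^ (k ^ 2) * x ^ k)) 0 (by
      intro k hk
      rcases hk.lt_or_gt with hk | hk <;> simp [invEulerProd, hk.not_ge])
    simpa [eulerProd, invEulerProd] using h
  | succ N ih =>
    rw [Finset.prod_range_succ]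
    have hsub := ((Equiv.subRight (1 : ℤ)).hasSum_iff.mpr ih).mul_left (x * p ^ (2 * N + 1))
    have hadd := ((Equiv.addRight (1 : ℤ)).hasSum_iff.mpr ih).mul_left (x⁻¹ * p ^ (2 * N + 1))
    have h := ((ih.mul_left (1 + p ^ (4 * N + 2))).add hsub).add hadd
    refine (congr_arg₂ (fun f a => HasSum f a) ?_ ?_).mpr h
    · funext k
      have e1 : invEulerProd (p ^ 2) (N + k) =
          (1 - (p ^ 2) ^ (N + 1 + k : ℤ)) * invEulerProd (p ^ 2) (N + 1 + k) := by
        rw [← invEulerProd_sub_one hp]; congr 1; ring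
      have e2 : invEulerProd (p ^ 2) (N - k) =
          (1 - (p ^ 2) ^ (N + 1 - k : ℤ)) * invEulerProd (p ^ 2) (N + 1 - k) := by
        rw [← invEulerProd_sub_one hp]; congr 1; ring
      have e3 : invEulerProd (p ^ 2) (N + (k - 1)) =
          (1 - (p ^ 2) ^ (N + k : ℤ)) * invEulerProd (p ^ 2) (N + k) := by
        rw [← invEulerProd_sub_one hp]; congr 1; ring
      have e4 : invEulerProd (p ^ 2) (N - (k + 1)) =
          (1 - (p ^ 2) ^ (N - k : ℤ)) * invEulerProd (p ^ 2) (N - k) := by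
        rw [← invEulerProd_sub_one hp]; congr 1; ring
      have e5 : (N - (k - 1) : ℤ) = N + 1 - k := by ring
      have e6 : (N + (k + 1) : ℤ) = N + 1 + k := by ring
      have e7 : p ^ ((k - 1) ^ 2) = p ^ (k ^ 2) * (p ^ k)⁻¹ ^ 2 * p := by
        rw [show (k - 1) ^ 2 = k ^ 2 + -k + -k + 1 by ring]
        simp only [zpow_add₀ hp0, zpow_neg, zpow_one]; ring
      have e8 : p ^ ((k + 1) ^ 2) = p ^ (k ^ 2) * (p ^ k) ^ 2 * p := by
        rw [show (k + 1) ^ 2 = k ^ 2 + k + k + 1 by ring]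
        simp only [zpow_add₀ hp0, zpow_one]; ring
      have hpk : p ^ k ≠ 0 := zpow_ne_zero k hp0
      have sq (j : ℤ) : (p ^ 2) ^ j = (p ^ j) ^ 2 := by
        rw [← zpow_natCast, ← zpow_natCast, zpow_comm]
      simp only [Function.comp, Equiv.subRight_apply, Equiv.coe_addRight, e5, e6, e3, e4, e1, e2,
        e7, e8, Nat.cast_add, Nat.cast_one, sq, show 2 * (N + 1) = 2 * N + 1 + 1 by ring,
        eulerProd_succ, zpow_add₀ hp0, zpow_sub₀ hp0, zpow_sub₀ hx, zpow_add₀ hx, zpow_one,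
        zpow_natCast]
      generalize p ^ (k ^ 2) = s
      generalize p ^ k = u at *
      generalize invEulerProd (p ^ 2) _ = B
      generalize invEulerProd (p ^ 2) _ = C
      field_simp
      ring
    · field_simp
      ring

lemma exists_tendsto_eulerProd {q : ℂ} (hq : ‖q‖ < 1) :
    ∃ A : ℂ, A ≠ 0 ∧ Tendsto (eulerProd q) atTop (𝓝 A) := by
  refine ⟨∏' n : ℕ, (1 - q ^ (n + 1)), ?_,
    (ModularForm.multipliable_one_sub_pow hq).hasProd.tendsto_prod_nat⟩
  have h := tprod_one_add_ne_zero_of_summable (f := fun n : ℕ => -q ^ (n + 1))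
    (fun n => by simpa [← sub_eq_add_neg] using one_sub_pow_succ_ne_zero hq n)
    (by simpa using (summable_nat_add_iff 1).mpr (summable_geometric_of_lt_one (norm_nonneg _) hq))
  simpa [← sub_eq_add_neg] using h

lemma tendsto_invEulerProd {q A : ℂ} (hA : A ≠ 0) (h : Tendsto (eulerProd q) atTop (𝓝 A)) :
    Tendsto (invEulerProd q) atTop (𝓝 A⁻¹) := by
  have ht : Tendsto Int.toNat atTop atTop :=
    tendsto_atTop.mpr fun n => (eventually_ge_atTop (n : ℤ)).mono fun k hk => by omega
  refine ((h.comp ht).inv₀ hA).congr' ?_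
  filter_upwards [eventually_ge_atTop (0 : ℤ)] with k hk
  simp [invEulerProd, hk]

lemma exists_norm_eulerProd_le {q A : ℂ} (h : Tendsto (eulerProd q) atTop (𝓝 A)) :
    ∃ C, ∀ n, ‖eulerProd q n‖ ≤ C := by
  obtain ⟨C, hC⟩ := (Metric.isBounded_range_of_tendsto _ h).exists_norm_le
  exact ⟨C, fun n => hC _ ⟨n, rfl⟩⟩

lemma exists_norm_invEulerProd_le {q A : ℂ} (hA : A ≠ 0)
    (h : Tendsto (eulerProd q) atTop (𝓝 A)) :
    ∃ C, ∀ k, ‖invEulerProd q k‖ ≤ C := by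
  obtain ⟨C, hC⟩ := (Metric.isBounded_range_of_tendsto _ (h.inv₀ hA)).exists_norm_le
  refine ⟨C, fun k => ?_⟩
  unfold invEulerProd
  split_ifs
  · exact hC _ ⟨k.toNat, rfl⟩
  · simpa using (norm_nonneg _).trans (hC _ ⟨0, rfl⟩)

/-- The partial products of the Jacobi triple product converge to the theta series. -/
lemma tendsto_prod_jacobi_triple_product {p x : ℂ} (hp0 : p ≠ 0) (hp : ‖p ^ 2‖ < 1) (hx : x ≠ 0)
    (hs : Summable fun k : ℤ => p ^ (k ^ 2) * x ^ k) :
    Tendsto (fun N => ∏ m ∈ Finset.range N, (1 - (p ^ 2) ^ (m + 1)) *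
        (1 + x * p ^ (2 * m + 1)) * (1 + x⁻¹ * p ^ (2 * m + 1)))
      atTop (𝓝 (∑' k : ℤ, p ^ (k ^ 2) * x ^ k)) := by
  obtain ⟨A, hA, hlim⟩ := exists_tendsto_eulerProd hp
  obtain ⟨C, hC⟩ := exists_norm_eulerProd_le hlim
  obtain ⟨D, hD⟩ := exists_norm_invEulerProd_le hA hlim
  have hC0 : 0 ≤ C := (norm_nonneg _).trans (hC 0)
  have hD0 : 0 ≤ D := (norm_nonneg _).trans (hD 0)
  have hinv := tendsto_invEulerProd hA hlim
  have key := tendsto_tsum_of_dominated_convergence (𝓕 := atTop)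
    (f := fun (N : ℕ) (k : ℤ) => eulerProd (p ^ 2) N * (eulerProd (p ^ 2) (2 * N) *
      invEulerProd (p ^ 2) (N + k) * invEulerProd (p ^ 2) (N - k) * (p ^ (k ^ 2) * x ^ k)))
    (g := fun k : ℤ => p ^ (k ^ 2) * x ^ k)
    (bound := fun k : ℤ => C * (C * D * D * ‖p ^ (k ^ 2) * x ^ k‖))
    ((hs.norm.mul_left _).mul_left _) ?_ ?_
  · refine key.congr fun N => ?_
    rw [((hasSum_finite_jacobi_triple_product hp0 hp hx N).mul_left _).tsum_eq, eulerProd,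
      ← Finset.prod_mul_distrib]
    exact Finset.prod_congr rfl fun m _ => (mul_assoc _ _ _).symm
  · intro k
    have h2 : Tendsto (fun N : ℕ => 2 * N) atTop atTop :=
      tendsto_atTop_mono (fun N => show N ≤ 2 * N by omega) tendsto_id
    have hadd : Tendsto (fun N : ℕ => (N : ℤ) + k) atTop atTop :=
      tendsto_atTop_add_const_right _ k tendsto_natCast_atTop_atTop
    have hsub : Tendsto (fun N : ℕ => (N : ℤ) - k) atTop atTop :=
      tendsto_atTop_add_const_right _ (-k) tendsto_natCast_atTop_atTop
    have h := hlim.mul ((((hlim.comp h2).mul (hinv.comp hadd)).mul (hinv.comp hsub)).mul_const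
      (p ^ (k ^ 2) * x ^ k))
    rwa [show A * (A * A⁻¹ * A⁻¹ * (p ^ (k ^ 2) * x ^ k)) = p ^ (k ^ 2) * x ^ k by
      field_simp] at h
  · refine Eventually.of_forall fun N k => ?_
    simp only [norm_mul (eulerProd (p ^ 2) _), norm_mul (_ * _) (_ * _),
      norm_mul (_ * _) (invEulerProd _ _)]
    gcongr
    all_goals first | exact hC _ | exact hD _

lemma multipliable_jacobi_triple_product {p : ℂ} (hp : ‖p‖ < 1) (x y : ℂ) :
    Multipliable fun m : ℕ => (1 - (p ^ 2) ^ (m + 1)) *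
        (1 + x * p ^ (2 * m + 1)) * (1 + y * p ^ (2 * m + 1)) := by
  have hp2 : ‖p ^ 2‖ < 1 := by
    rw [norm_pow]; exact pow_lt_one₀ (norm_nonneg p) hp two_ne_zero
  have hfactor (w : ℂ) : Multipliable fun m : ℕ => 1 + w * p ^ (2 * m + 1) := by
    apply multipliable_one_add_of_summable
    have h := (summable_geometric_of_lt_one (norm_nonneg _) hp2).mul_left (‖w‖ * ‖p‖)
    refine h.congr fun m => ?_
    rw [norm_mul, norm_pow, norm_pow]; ring
  exact ((ModularForm.multipliable_one_sub_pow hp2).mul (hfactor x)).mul (hfactor y)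

/-- The Jacobi triple product identity: for `Im τ > 0`,
`ϑ(z|τ) = ∏_{m≥0} (1-q^{m+1})(1+e^{2πiz}q^{m+1/2})(1+e^{-2πiz}q^{m+1/2})`,
where `ϑ(z|τ) = ∑_{m∈ℤ} e^{2πizm+πiτm²}` is `jacobiTheta₂ z τ`. -/
theorem jacobi_triple_product (τ z : ℂ) (hτ : 0 < τ.im) :
    Multipliable (fun m : ℕ =>
      (1 - Complex.exp (2 * Real.pi * Complex.I * (m + 1) * τ)) *
        (1 + Complex.exp (2 * Real.pi * Complex.I * z) *
              Complex.exp (Real.pi * Complex.I * (2 * m + 1) * τ)) *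
        (1 + Complex.exp (-(2 * Real.pi * Complex.I * z)) *
              Complex.exp (Real.pi * Complex.I * (2 * m + 1) * τ))) ∧
    (∏' m : ℕ,
      (1 - Complex.exp (2 * Real.pi * Complex.I * (m + 1) * τ)) *
        (1 + Complex.exp (2 * Real.pi * Complex.I * z) *
              Complex.exp (Real.pi * Complex.I * (2 * m + 1) * τ)) *
        (1 + Complex.exp (-(2 * Real.pi * Complex.I * z)) *
              Complex.exp (Real.pi * Complex.I * (2 * m + 1) * τ))) =
      jacobiTheta₂ z τ := by
  set p := cexp (Real.pi * I * τ) with hp_def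
  set x := cexp (2 * Real.pi * I * z) with hx_def
  have hp0 : p ≠ 0 := exp_ne_zero _
  have hx : x ≠ 0 := exp_ne_zero _
  have hp : ‖p‖ < 1 := by
    rw [hp_def, norm_exp, Real.exp_lt_one_iff]
    simpa using mul_pos Real.pi_pos hτ
  have hp2 : ‖p ^ 2‖ < 1 := by
    rw [norm_pow]; exact pow_lt_one₀ (norm_nonneg p) hp two_ne_zero
  have hodd (m : ℕ) : cexp (Real.pi * I * (2 * m + 1) * τ) = p ^ (2 * m + 1) := by
    rw [hp_def, ← exp_nat_mul]; push_cast; ring_nf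
  have heven (m : ℕ) : cexp (2 * Real.pi * I * (m + 1) * τ) = (p ^ 2) ^ (m + 1) := by
    rw [hp_def, ← exp_nat_mul, ← exp_nat_mul]; push_cast; ring_nf
  have hterm (k : ℤ) : jacobiTheta₂_term k z τ = p ^ (k ^ 2) * x ^ k := by
    rw [hp_def, hx_def, ← exp_int_mul, ← exp_int_mul, ← exp_add, jacobiTheta₂_term]
    push_cast; ring_nf
  simp only [hodd, heven, exp_neg, ← hx_def]
  have hsum := hasSum_jacobiTheta₂_term z hτ
  simp only [hterm] at hsum
  have hmul := multipliable_jacobi_triple_product hp x x⁻¹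
  refine ⟨hmul, tendsto_nhds_unique hmul.hasProd.tendsto_prod_nat ?_⟩
  rw [← hsum.tsum_eq]
  exact tendsto_prod_jacobi_triple_product hp0 hp2 hx hsum.summable
end

section
/- Let F(τ) = η(2τ)^{28}/η(τ)^{28} for τ with Im τ > 0. For every a, b, c, d ∈ ℤ with ad − bc = 1 and c ≡ 0 (mod 2), there exists w ∈ ℂ with w⁶ = 1 such that F((aτ+b)/(cτ+d)) = w·F(τ) for all τ ∈ ℂ with Im τ > 0. -/
/-- The Dedekind eta function `η(τ) = e^{πiτ/12} ∏_{n≥1} (1 - e^{2πinτ})`. -/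
noncomputable def dedekindEta (τ : ℂ) : ℂ :=
  Complex.exp (Real.pi * Complex.I * τ / 12) *
    ∏' n : ℕ, (1 - Complex.exp (2 * Real.pi * Complex.I * (n + 1) * τ))

/-- `F(τ) = η(2τ)^28 / η(τ)^28`. -/
noncomputable def F2B (τ : ℂ) : ℂ :=
  dedekindEta (2 * τ) ^ 28 / dedekindEta τ ^ 28

open ModularForm in
/-- `dedekindEta` is Mathlib's eta function. -/
theorem dedekindEta_eq_eta : dedekindEta = ModularForm.eta := by
  funext τ
  simp only [dedekindEta, ModularForm.eta, eta_q_eq_cexp, Function.Periodic.qParam]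
  congr 2
  push_cast
  ring

theorem dedekindEta_ne_zero {τ : ℂ} (hτ : 0 < τ.im) : dedekindEta τ ≠ 0 := by
  rw [dedekindEta_eq_eta]
  exact ModularForm.eta_ne_zero hτ

theorem differentiableAt_dedekindEta {τ : ℂ} (hτ : 0 < τ.im) :
    DifferentiableAt ℂ dedekindEta τ := by
  rw [dedekindEta_eq_eta]
  exact ModularForm.differentiableAt_eta_of_mem_upperHalfPlaneSet hτ

section Moebius

open UpperHalfPlane MatrixGroups ModularForm

variable {a b c d : ℤ}

theorem coe_mk_SL_smul (h : a * d - b * c = 1) (z : ℍ) :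
    ((show SL(2, ℤ) from ⟨!![a, b; c, d], by rw [Matrix.det_fin_two_of, h]⟩) • z : ℍ) =
      ((a * z + b) / (c * z + d) : ℂ) := by
  rw [UpperHalfPlane.specialLinearGroup_apply]
  simp

theorem moebius_im_pos (h : a * d - b * c = 1) {τ : ℂ} (hτ : 0 < τ.im) :
    0 < ((a * τ + b) / (c * τ + d) : ℂ).im := by
  rw [← coe_mk_SL_smul h ⟨τ, hτ⟩]
  exact UpperHalfPlane.im_pos _

theorem moebius_denom_ne_zero (h : a * d - b * c = 1) {τ : ℂ} (hτ : 0 < τ.im) :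
    (c * τ + d : ℂ) ≠ 0 := by
  intro h0
  simpa [h0] using moebius_im_pos h hτ

/-- The 24th power of eta transforms as a modular form of weight 12. -/
theorem dedekindEta_pow_24_moebius (h : a * d - b * c = 1) {τ : ℂ} (hτ : 0 < τ.im) :
    dedekindEta ((a * τ + b) / (c * τ + d)) ^ 24 =
      (c * τ + d) ^ 12 * dedekindEta τ ^ 24 := by
  have key := congrFun (SlashInvariantForm.slash_action_generators_SL2Z discriminant_S_invariant
    discriminant_T_invariant
    (show SL(2, ℤ) from ⟨!![a, b; c, d], by rw [Matrix.det_fin_two_of, h]⟩)) ⟨τ, hτ⟩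
  rw [SL_slash_apply, discriminant, discriminant, coe_mk_SL_smul h, ← dedekindEta_eq_eta,
    ModularGroup.denom_apply, zpow_neg, zpow_ofNat] at key
  change dedekindEta ((a * τ + b) / (c * τ + d)) ^ 24 * ((c * τ + d : ℂ) ^ (12 : ℕ))⁻¹ =
    dedekindEta τ ^ 24 at key
  rw [← key, mul_left_comm, mul_inv_cancel₀ (pow_ne_zero _ (moebius_denom_ne_zero h hτ)), mul_one]

end Moebius

theorem F2B_ne_zero {τ : ℂ} (hτ : 0 < τ.im) : F2B τ ≠ 0 :=
  div_ne_zero (pow_ne_zero _ (dedekindEta_ne_zero (by simpa using hτ)))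
    (pow_ne_zero _ (dedekindEta_ne_zero hτ))

theorem differentiableAt_F2B {τ : ℂ} (hτ : 0 < τ.im) : DifferentiableAt ℂ F2B τ := by
  have h2 : DifferentiableAt ℂ (fun z ↦ dedekindEta (2 * z)) τ :=
    (differentiableAt_dedekindEta (by simpa using hτ)).comp τ
      (by fun_prop : DifferentiableAt ℂ (fun z : ℂ ↦ 2 * z) τ)
  exact (h2.pow 28).div ((differentiableAt_dedekindEta hτ).pow 28)
    (pow_ne_zero _ (dedekindEta_ne_zero hτ))

theorem F2B_pow_six (τ : ℂ) :
    F2B τ ^ 6 = (dedekindEta (2 * τ) ^ 24 / dedekindEta τ ^ 24) ^ 7 := by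
  simp only [F2B, div_pow, ← pow_mul]

/-- The sixth power of `F2B` is invariant under `Γ₀(2)`. -/
theorem F2B_pow_six_moebius {a b c d : ℤ} (h : a * d - b * c = 1) (hc : (2 : ℤ) ∣ c)
    {τ : ℂ} (hτ : 0 < τ.im) : F2B ((a * τ + b) / (c * τ + d)) ^ 6 = F2B τ ^ 6 := by
  obtain ⟨e, rfl⟩ := hc
  have hden := moebius_denom_ne_zero h hτ
  have h' : a * d - (2 * b) * e = 1 := by rw [← h]; ring
  have htwo := dedekindEta_pow_24_moebius h' (τ := 2 * τ) (by simpa using hτ)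
  have harg : 2 * ((a * τ + b) / ((2 * e : ℤ) * τ + d)) =
      (a * (2 * τ) + (2 * b : ℤ)) / (e * (2 * τ) + d) := by
    push_cast
    rw [← mul_div_assoc]
    congr 1 <;> ring
  have hden_eq : (e * (2 * τ) + d : ℂ) = (2 * e : ℤ) * τ + d := by
    push_cast
    ring
  rw [F2B_pow_six, F2B_pow_six, harg, htwo, hden_eq, dedekindEta_pow_24_moebius h hτ,
    mul_div_mul_left _ _ (pow_ne_zero _ hden)]

/-- The span of `F(τ) = η(2τ)^28/η(τ)^28` is preserved, up to a sixth root of unity,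
by every element of `Γ₀(2)`. -/
theorem gamma0_2_invariance_2B (a b c d : ℤ) (h : a * d - b * c = 1) (hc : (2 : ℤ) ∣ c) :
    ∃ w : ℂ, w ^ 6 = 1 ∧ ∀ τ : ℂ, 0 < τ.im →
      F2B (((a : ℂ) * τ + (b : ℂ)) / ((c : ℂ) * τ + (d : ℂ))) = w * F2B τ := by
  set quot : ℂ → ℂ := fun τ ↦ F2B ((a * τ + b) / (c * τ + d)) / F2B τ with hquot
  have hroot : Set.MapsTo quot {τ | 0 < τ.im} {w | w ^ 6 = 1} := fun τ hτ ↦ by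
    rw [Set.mem_ofPred_eq, hquot, div_pow, F2B_pow_six_moebius h hc hτ,
      div_self (pow_ne_zero _ (F2B_ne_zero hτ))]
  have hcont : ContinuousOn quot {τ | 0 < τ.im} := fun τ hτ ↦ by
    have hmoebius : DifferentiableAt ℂ (fun z : ℂ ↦ (a * z + b) / (c * z + d)) τ :=
      DifferentiableAt.div (by fun_prop) (by fun_prop) (moebius_denom_ne_zero h hτ)
    exact (((differentiableAt_F2B (moebius_im_pos h hτ)).comp τ hmoebius).div
      (differentiableAt_F2B hτ) (F2B_ne_zero hτ)).continuousAt.continuousWithinAt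
  have hfinite : {w : ℂ | w ^ 6 = 1}.Finite := by
    refine (Polynomial.nthRoots 6 (1 : ℂ)).toFinset.finite_toSet.subset fun w hw ↦ ?_
    simpa [Polynomial.mem_nthRoots] using hw
  have hI : (0 : ℝ) < Complex.I.im := by simp
  refine ⟨quot Complex.I, hroot hI, fun τ hτ ↦ ?_⟩
  rw [← (convex_halfSpace_im_gt 0).isPreconnected.constant_of_mapsTo
    hfinite.isDiscrete hcont hroot hτ hI]
  exact (div_mul_cancel₀ _ (F2B_ne_zero hτ)).symm
end
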